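/- Let pi be a smooth Fpbar-representation of G. If v in pi is fixed by the pro-p Iwahori subgroup I_{1,K}, then both S_K(v) and S_-(v) are fixed by I_{1,K}. -/

import Mathlib

open scoped Classical

noncomputable section

namespace U21

/-- The arithmetic setting: `E` is the unramified quadratic extension of a non-archimedean
local field `F` of odd residue characteristic `p`, with residue field of `F` of cardinality
`q = p ^ fdeg`.  The field `E` is encoded through its valuation subring `O = o_E`, a
uniformizer `ϖ`, the maximal ideal `mI` (so that `p_E^k` is `ϖ ^ k * O`), and the nontrivial
`F`-automorphism `conj` of `E` (which induces the `q`-power Frobenius on the residue field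
of `E`, of cardinality `q ^ 2`). -/
structure Setting where
  p : ℕ
  q : ℕ
  fdeg : ℕ
  hp : p.Prime
  hodd : p ≠ 2
  hfdeg : 0 < fdeg
  hq : q = p ^ fdeg
  E : Type
  [fieldE : Field E]
  conj : E →+* E
  conj_invol : ∀ x, conj (conj x) = x
  conj_ne : conj ≠ RingHom.id E
  O : Subring E
  val_ring : ∀ x : E, x ≠ 0 → x ∈ O ∨ x⁻¹ ∈ O
  conj_O : ∀ x, x ∈ O → conj x ∈ O
  ϖ : E
  unif_mem : ϖ ∈ O
  unif_ne : ϖ ≠ 0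
  unif_conj : conj ϖ = ϖ
  unif_not_unit : ¬ IsUnit (⟨ϖ, unif_mem⟩ : O)
  disc : ∀ x : E, x ≠ 0 → ∃ (n : ℤ) (u : Oˣ), x = (u : O) * ϖ ^ n
  mI : Ideal O
  hmI : ∀ x : O, x ∈ mI ↔ ∃ y ∈ O, (x : E) = ϖ * y
  [fin_res : Fintype (O ⧸ mI)]
  card_res : Fintype.card (O ⧸ mI) = q ^ 2
  res_frob : ∀ x : O, Ideal.Quotient.mk mI ⟨conj x, conj_O x x.2⟩ = (Ideal.Quotient.mk mI x) ^ q
  complete : ∀ a : ℕ → E,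
    (∀ k : ℕ, ∃ N, ∀ m ≥ N, ∀ n ≥ N, ∃ w ∈ O, a m - a n = ϖ ^ k * w) →
    ∃ L : E, ∀ k : ℕ, ∃ N, ∀ n ≥ N, ∃ w ∈ O, a n - L = ϖ ^ k * w

attribute [instance] Setting.fieldE Setting.fin_res

namespace Setting

variable (S : Setting)

/-- 3×3 matrices over `E`. -/
abbrev M3 := Matrix (Fin 3) (Fin 3) S.E

/-- The antidiagonal matrix `β` of the Hermitian form. -/
def betaM : S.M3 := !![0,0,1;0,1,0;1,0,0]

/-- The fractional ideal `p_E ^ k ⊆ E` (for `k : ℤ`). -/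
def pE (k : ℤ) : Set S.E := {z | ∃ w ∈ S.O, z = S.ϖ ^ k * w}

/-- The unramified unitary group `G = U(2,1)(E/F)`, as a subgroup of `GL₃(E)`:
`g ∈ G` iff `g.transpose * β * conj g = β`. -/
def Gsub : Subgroup (Matrix.GeneralLinearGroup (Fin 3) S.E) where
  carrier := {g | ((g : S.M3)).transpose * S.betaM * ((g : S.M3).map S.conj) = S.betaM}
  one_mem' := by
    simp [Matrix.map_one (⇑S.conj) (map_zero S.conj) (map_one S.conj)]
  mul_mem' := by
    intro a b ha hb
    simp only [Set.mem_setOf_eq, Units.val_mul, Matrix.transpose_mul, Matrix.map_mul] at ha hb ⊢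
    calc ((b : S.M3)).transpose * ((a : S.M3)).transpose * S.betaM * ((a : S.M3).map S.conj * (b : S.M3).map S.conj)
        = ((b : S.M3)).transpose * (((a : S.M3)).transpose * S.betaM * (a : S.M3).map S.conj) * ((b : S.M3).map S.conj) := by
          simp only [mul_assoc]
      _ = S.betaM := by rw [ha]; exact hb
  inv_mem' := by
    intro a ha
    simp only [Set.mem_setOf_eq] at ha ⊢
    have hA : IsUnit ((a : S.M3)) := a.isUnit
    have hdet : IsUnit ((a : S.M3)).det := (Matrix.isUnit_iff_isUnit_det _).mp hA
    have hAc : IsUnit (((a : S.M3)).map ⇑S.conj) := by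
      rw [← RingHom.mapMatrix_apply]; exact hA.map _
    have hdetc : IsUnit ((((a : S.M3)).map ⇑S.conj).det) := (Matrix.isUnit_iff_isUnit_det _).mp hAc
    have hdetT : IsUnit ((((a : S.M3)).transpose).det) := by rw [Matrix.det_transpose]; exact hdet
    have hmapinv : ((a : S.M3)⁻¹).map ⇑S.conj = (((a : S.M3)).map ⇑S.conj)⁻¹ := by
      symm
      apply Matrix.inv_eq_left_inv
      rw [← Matrix.map_mul, Matrix.nonsing_inv_mul _ hdet,
        Matrix.map_one (⇑S.conj) (map_zero S.conj) (map_one S.conj)]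
    rw [Matrix.coe_units_inv, Matrix.transpose_nonsing_inv, hmapinv]
    conv_lhs => rw [← ha]
    calc (((a:S.M3)).transpose)⁻¹ * (((a:S.M3)).transpose * S.betaM * ((a:S.M3)).map ⇑S.conj) * (((a:S.M3)).map ⇑S.conj)⁻¹
        = (((a:S.M3)).transpose)⁻¹ * ((a:S.M3)).transpose * S.betaM *
            (((a:S.M3)).map ⇑S.conj * (((a:S.M3)).map ⇑S.conj)⁻¹) := by simp only [mul_assoc]
      _ = S.betaM := by
          rw [Matrix.nonsing_inv_mul _ hdetT, Matrix.mul_nonsing_inv _ hdetc, one_mul, mul_one]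

/-- The group `G = U(2,1)(E/F)`. -/
abbrev GG := ↥S.Gsub

/-- The matrix of an element of `G`. -/
def mat (g : S.GG) : S.M3 := ((g : Matrix.GeneralLinearGroup (Fin 3) S.E) : S.M3)

/-- The upper unipotent matrix `n(x,y)`. -/
def nM (x y : S.E) : S.M3 := !![1, x, y; 0, 1, -S.conj x; 0, 0, 1]

/-- The lower unipotent matrix `n'(x,y)`. -/
def n'M (x y : S.E) : S.M3 := !![1, 0, 0; x, 1, 0; y, -S.conj x, 1]

/-- The diagonal matrix `h(x) = diag(x, -x̄x⁻¹, x̄⁻¹)`. -/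
def hM (x : S.E) : S.M3 := !![x, 0, 0; 0, -S.conj x * x⁻¹, 0; 0, 0, (S.conj x)⁻¹]

/-- The subgroup `N` of `G` (unipotent radical of the upper triangular Borel), as a set. -/
def Nset : Set S.GG := {g | ∃ x y : S.E, x * S.conj x + y + S.conj y = 0 ∧ S.mat g = S.nM x y}

/-- The subgroup `N_k = {n(x,y) : y ∈ p_E^k}`, as a set. -/
def Nk (k : ℤ) : Set S.GG :=
  {g | ∃ x y : S.E, x * S.conj x + y + S.conj y = 0 ∧ y ∈ S.pE k ∧ S.mat g = S.nM x y}

/-- The subgroup `N'` of `G`, as a set. -/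
def N'set : Set S.GG := {g | ∃ x y : S.E, x * S.conj x + y + S.conj y = 0 ∧ S.mat g = S.n'M x y}

/-- The subgroup `N'_k = {n'(x,y) : y ∈ p_E^k}`, as a set. -/
def N'k (k : ℤ) : Set S.GG :=
  {g | ∃ x y : S.E, x * S.conj x + y + S.conj y = 0 ∧ y ∈ S.pE k ∧ S.mat g = S.n'M x y}

/-- The diagonal subgroup `H` of `G`, as a set. -/
def Hset : Set S.GG := {g | ∃ a b c : S.E, S.mat g = !![a,0,0;0,b,0;0,0,c]}

/-- The hyperspecial maximal compact subgroup `K₀ = G ∩ GL₃(o_E)`, as a set. -/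
def K0set : Set S.GG := {g | ∀ i j, S.mat g i j ∈ S.O}

/-- The special (non-hyperspecial) maximal compact subgroup `K₁`, as a set. -/
def K1set : Set S.GG :=
  {g | S.mat g 0 0 ∈ S.O ∧ S.mat g 0 1 ∈ S.O ∧ S.mat g 0 2 ∈ S.pE (-1) ∧
       S.mat g 1 0 ∈ S.pE 1 ∧ S.mat g 1 1 ∈ S.O ∧ S.mat g 1 2 ∈ S.O ∧
       S.mat g 2 0 ∈ S.pE 1 ∧ S.mat g 2 1 ∈ S.pE 1 ∧ S.mat g 2 2 ∈ S.O}

/-- The Iwahori subgroup `I_{K₀}` (preimage of the Borel of `Γ_{K₀}`), as a set. -/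
def IK0 : Set S.GG :=
  {g | g ∈ S.K0set ∧ S.mat g 1 0 ∈ S.pE 1 ∧ S.mat g 2 0 ∈ S.pE 1 ∧ S.mat g 2 1 ∈ S.pE 1}

/-- The pro-p Iwahori subgroup `I_{1,K₀}`, as a set. -/
def I1K0 : Set S.GG :=
  {g | g ∈ S.IK0 ∧ S.mat g 0 0 - 1 ∈ S.pE 1 ∧ S.mat g 1 1 - 1 ∈ S.pE 1 ∧ S.mat g 2 2 - 1 ∈ S.pE 1}

/-- The opposite pro-p Iwahori subgroup `I'_{1,K₀}`, as a set. -/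
def I1'K0 : Set S.GG :=
  {g | g ∈ S.K0set ∧ S.mat g 0 1 ∈ S.pE 1 ∧ S.mat g 0 2 ∈ S.pE 1 ∧ S.mat g 1 2 ∈ S.pE 1 ∧
       S.mat g 0 0 - 1 ∈ S.pE 1 ∧ S.mat g 1 1 - 1 ∈ S.pE 1 ∧ S.mat g 2 2 - 1 ∈ S.pE 1}

/-- The maximal normal pro-p subgroup `K₀¹` of `K₀` (principal congruence subgroup), as a set. -/
def Kone0 : Set S.GG := {g | ∀ i j, S.mat g i j - (1 : S.M3) i j ∈ S.pE 1}

/-- The Iwahori subgroup `I_{K₁}`, as a set. -/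
def IK1 : Set S.GG := {g | g ∈ S.K1set ∧ S.mat g 2 0 ∈ S.pE 2}

/-- The pro-p Iwahori subgroup `I_{1,K₁}`, as a set. -/
def I1K1 : Set S.GG :=
  {g | g ∈ S.IK1 ∧ S.mat g 0 0 - 1 ∈ S.pE 1 ∧ S.mat g 1 1 - 1 ∈ S.pE 1 ∧ S.mat g 2 2 - 1 ∈ S.pE 1}

/-- The opposite pro-p Iwahori subgroup `I'_{1,K₁}`, as a set. -/
def I1'K1 : Set S.GG :=
  {g | g ∈ S.K1set ∧ S.mat g 0 2 ∈ S.O ∧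
       S.mat g 0 0 - 1 ∈ S.pE 1 ∧ S.mat g 1 1 - 1 ∈ S.pE 1 ∧ S.mat g 2 2 - 1 ∈ S.pE 1}

/-- The maximal normal pro-p subgroup `K₁¹` of `K₁`, as a set. -/
def Kone1 : Set S.GG :=
  {g | g ∈ S.K1set ∧ S.mat g 0 2 ∈ S.O ∧ S.mat g 2 0 ∈ S.pE 2 ∧
       S.mat g 0 0 - 1 ∈ S.pE 1 ∧ S.mat g 1 1 - 1 ∈ S.pE 1 ∧ S.mat g 2 2 - 1 ∈ S.pE 1}

/-- The congruence subgroup of level `n` (used to express smoothness), as a set. -/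
def cong (n : ℕ) : Set S.GG := {g | ∀ i j, S.mat g i j - (1 : S.M3) i j ∈ S.pE n}

def alphaM : S.M3 := !![S.ϖ⁻¹, 0, 0; 0, 1, 0; 0, 0, S.ϖ]

def alphaMinv : S.M3 := !![S.ϖ, 0, 0; 0, 1, 0; 0, 0, S.ϖ⁻¹]

lemma alpha_mul_inv : S.alphaM * S.alphaMinv = 1 := by
  ext i j
  fin_cases i <;> fin_cases j <;>
    simp [alphaM, alphaMinv, Matrix.mul_apply, Fin.sum_univ_three, Matrix.one_apply,
      Matrix.vecHead, Matrix.vecTail, inv_mul_cancel₀ S.unif_ne, mul_inv_cancel₀ S.unif_ne]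

lemma alpha_inv_mul : S.alphaMinv * S.alphaM = 1 := by
  ext i j
  fin_cases i <;> fin_cases j <;>
    simp [alphaM, alphaMinv, Matrix.mul_apply, Fin.sum_univ_three, Matrix.one_apply,
      Matrix.vecHead, Matrix.vecTail, inv_mul_cancel₀ S.unif_ne, mul_inv_cancel₀ S.unif_ne]

def alphaU : Matrix.GeneralLinearGroup (Fin 3) S.E :=
  ⟨S.alphaM, S.alphaMinv, S.alpha_mul_inv, S.alpha_inv_mul⟩

lemma alphaU_mem : S.alphaU ∈ S.Gsub := by
  show ((S.alphaU : S.M3)).transpose * S.betaM * ((S.alphaU : S.M3).map S.conj) = S.betaM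
  have : (S.alphaU : S.M3) = S.alphaM := rfl
  rw [this]
  ext i j
  fin_cases i <;> fin_cases j <;>
    simp [alphaM, betaM, Matrix.mul_apply, Fin.sum_univ_three, Matrix.map_apply,
      Matrix.transpose_apply, Matrix.vecHead, Matrix.vecTail, map_inv₀, S.unif_conj,
      inv_mul_cancel₀ S.unif_ne, mul_inv_cancel₀ S.unif_ne]

/-- The element `α = diag(ϖ⁻¹, 1, ϖ)` of `G`. -/
def alphaE : S.GG := ⟨S.alphaU, S.alphaU_mem⟩

lemma beta_mul_beta : S.betaM * S.betaM = 1 := by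
  ext i j
  fin_cases i <;> fin_cases j <;>
    simp [betaM, Matrix.mul_apply, Fin.sum_univ_three, Matrix.one_apply,
      Matrix.vecHead, Matrix.vecTail]

def betaU : Matrix.GeneralLinearGroup (Fin 3) S.E :=
  ⟨S.betaM, S.betaM, S.beta_mul_beta, S.beta_mul_beta⟩

lemma betaU_mem : S.betaU ∈ S.Gsub := by
  show ((S.betaU : S.M3)).transpose * S.betaM * ((S.betaU : S.M3).map S.conj) = S.betaM
  have : (S.betaU : S.M3) = S.betaM := rfl
  rw [this]
  ext i j
  fin_cases i <;> fin_cases j <;>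
    simp [betaM, Matrix.mul_apply, Fin.sum_univ_three, Matrix.map_apply, Matrix.transpose_apply,
      Matrix.vecHead, Matrix.vecTail]

/-- The element `β` of `G`. -/
def betaE : S.GG := ⟨S.betaU, S.betaU_mem⟩

/-- The element `β' = β * α⁻¹` of `G`. -/
def betaPr : S.GG := S.betaE * S.alphaE⁻¹

/-- A finite set `U` is a set of representatives for the cosets `A/B`. -/
def IsReps (A B : Set S.GG) (U : Finset S.GG) : Prop :=
  (↑U : Set S.GG) ⊆ A ∧ ∀ a ∈ A, ∃! u, u ∈ U ∧ a⁻¹ * u ∈ B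

/-- The residue field `k_E` of `E`. -/
abbrev kE := S.O ⧸ S.mI

/-- The residue map `o_E → k_E`. -/
def resmap : S.O →+* S.kE := Ideal.Quotient.mk S.mI

/-- The group `L_{q³} = {(x,t) ∈ k_E² : x x̄ + t + t̄ = 0}` (where `x̄ = x^q`). -/
def Lbig : Set (S.kE × S.kE) := {z | z.1 * z.1 ^ S.q + z.2 + z.2 ^ S.q = 0}

/-- The group `L_q = {(0,t) ∈ k_E² : t + t̄ = 0}`. -/
def Lsmall : Set (S.kE × S.kE) := {z | z.1 = 0 ∧ z.2 + z.2 ^ S.q = 0}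

/-- `L_{q^t}` for `t ∈ {1,3}`. -/
def Lof (t : ℕ) : Set (S.kE × S.kE) := if t = 3 then S.Lbig else S.Lsmall

end Setting

/-- A choice of one of the two maximal compact open subgroups `K ∈ {K₀, K₁}` of `G`,
together with its maximal normal pro-p subgroup `K¹`, the (pro-p) Iwahori subgroups
`I_K ⊇ I_{1,K}`, the opposite pro-p Iwahori `I'_{1,K}`, the element
`β_K ∈ K ∩ {β, β'}`, and the integers `n_K, m_K, t_K`. -/
structure Chamber (S : Setting) where
  K : Subgroup S.GG
  KoneS : Set S.GG
  IK : Set S.GG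
  I1 : Set S.GG
  I1' : Set S.GG
  βK : S.GG
  nK : ℤ
  mK : ℤ
  tK : ℕ
  cases :
    ((K : Set S.GG) = S.K0set ∧ KoneS = S.Kone0 ∧ IK = S.IK0 ∧ I1 = S.I1K0 ∧ I1' = S.I1'K0 ∧
      βK = S.betaE ∧ nK = 0 ∧ mK = 1 ∧ tK = 3) ∨
    ((K : Set S.GG) = S.K1set ∧ KoneS = S.Kone1 ∧ IK = S.IK1 ∧ I1 = S.I1K1 ∧ I1' = S.I1'K1 ∧
      βK = S.betaPr ∧ nK = -1 ∧ mK = 2 ∧ tK = 1)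

namespace Chamber

variable {S : Setting} (C : Chamber S)

/-- `H₀ = H ∩ I_K`. -/
def H0 : Set S.GG := S.Hset ∩ C.IK

/-- `H₁ = H ∩ I_{1,K}`. -/
def H1 : Set S.GG := S.Hset ∩ C.I1

end Chamber

section RepTheory

variable {S : Setting} (C : Chamber S)
variable (𝔽 : Type) [Field 𝔽]

section Generic

variable {G₀ : Type} [Monoid G₀] {V : Type} [AddCommGroup V] [Module 𝔽 V]

/-- A submodule is invariant under a representation. -/
def Invt (ρ : Representation 𝔽 G₀ V) (Ssub : Submodule 𝔽 V) : Prop :=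
  ∀ g v, v ∈ Ssub → ρ g v ∈ Ssub

/-- The subrepresentation generated by a vector (the span of its orbit). -/
def orbitSpan (ρ : Representation 𝔽 G₀ V) (v : V) : Submodule 𝔽 V :=
  Submodule.span 𝔽 {w | ∃ g, w = ρ g v}

/-- The subrepresentation generated by a vector under a subset `A` of the group. -/
def orbitSpanOn (ρ : Representation 𝔽 G₀ V) (A : Set G₀) (v : V) : Submodule 𝔽 V :=
  Submodule.span 𝔽 {w | ∃ g ∈ A, w = ρ g v}

/-- The quotient of a representation by an invariant submodule `N` is irreducible:
equivalently (by the lattice correspondence), `N ≠ ⊤` and any invariant submodule lying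
between `N` and `⊤` equals `N` or `⊤`. -/
def QuotientIrreducible (ρ : Representation 𝔽 G₀ V) (N : Submodule 𝔽 V) : Prop :=
  N ≠ ⊤ ∧ ∀ Ssub : Submodule 𝔽 V, Invt 𝔽 ρ Ssub → N ≤ Ssub → Ssub = N ∨ Ssub = ⊤

/-- The submodule of vectors invariant under all elements of the subset `A`. -/
def invariantsOn (ρ : Representation 𝔽 G₀ V) (A : Set G₀) : Submodule 𝔽 V where
  carrier := {v | ∀ g ∈ A, ρ g v = v}
  add_mem' := by
    intro a b ha hb g hg
    rw [map_add, ha g hg, hb g hg]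
  zero_mem' := by
    intro g hg
    rw [map_zero]
  smul_mem' := by
    intro c a ha g hg
    rw [map_smul, ha g hg]

/-- The space `Hom_G(ρ₁, ρ₂)` of equivariant linear maps, as a submodule of the linear maps. -/
def EquivHomSub {V₂ : Type} [AddCommGroup V₂] [Module 𝔽 V₂]
    (ρ₁ : Representation 𝔽 G₀ V) (ρ₂ : Representation 𝔽 G₀ V₂) :
    Submodule 𝔽 (V →ₗ[𝔽] V₂) where
  carrier := {φ | ∀ g x, φ (ρ₁ g x) = ρ₂ g (φ x)}
  add_mem' := by
    intro a b ha hb g x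
    simp only [LinearMap.add_apply, ha g x, hb g x, map_add]
  zero_mem' := by
    intro g x
    simp only [LinearMap.zero_apply, map_zero]
  smul_mem' := by
    intro c a ha g x
    simp only [LinearMap.smul_apply, ha g x, map_smul]

end Generic

section Weight

variable (W : Type) [AddCommGroup W] [Module 𝔽 W]
variable (σ : Representation 𝔽 ↥C.K W)

/-- Extension of `σ` to all of `G` (by `1` outside `K`); used to avoid coercion issues. -/
def sigma' : S.GG → Module.End 𝔽 W := fun g => if h : g ∈ C.K then σ ⟨g, h⟩ else 1

/-- `σ` is a weight of `K`: an irreducible smooth representation of `K` over `𝔽`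
factoring through `Γ_K = K / K¹` (automatically finite dimensional). -/
def IsWeight : Prop :=
  Nontrivial W ∧ FiniteDimensional 𝔽 W ∧
  (∀ Ssub : Submodule 𝔽 W, (∀ (k : ↥C.K) (w : W), w ∈ Ssub → σ k w ∈ Ssub) → Ssub = ⊥ ∨ Ssub = ⊤) ∧
  (∀ (g : S.GG) (hg : g ∈ C.K), g ∈ C.KoneS → σ ⟨g, hg⟩ = LinearMap.id)

/-- `σ` is one dimensional of the form `χ ∘ det`. -/
def IsDetWeight : Prop :=
  Module.finrank 𝔽 W = 1 ∧
  ∃ c : S.E → 𝔽, ∀ (g : S.GG) (hg : g ∈ C.K) (w : W), σ ⟨g, hg⟩ w = c ((S.mat g).det) • w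

/-- `j_σ : σ → σ` is the composition of the coinvariant projection `σ → σ_{I'_{1,K}}`
with the inverse of the natural isomorphism `σ^{I_{1,K}} ≅ σ_{I'_{1,K}}`:
it restricts to the identity on `σ^{I_{1,K}}` and kills the augmentation part of
`σ` with respect to `I'_{1,K}`. -/
def IsJ (jσ : W →ₗ[𝔽] W) : Prop :=
  (∀ w : W, (∀ g ∈ C.I1, sigma' C 𝔽 W σ g w = w) → jσ w = w) ∧
  (∀ (w : W) (g : S.GG), g ∈ C.I1' → jσ (sigma' C 𝔽 W σ g w - w) = 0)

/-- The defining conditions of the compact induction `ind_K^G σ`: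
`K`-equivariance on the left and compact support (finitely many cosets `K g`). -/
def IndCarrier : Set (S.GG → W) :=
  {f | (∀ (k : S.GG) (hk : k ∈ C.K) (g : S.GG), f (k * g) = σ ⟨k, hk⟩ (f g)) ∧
       ∃ s : Finset S.GG, ∀ g : S.GG, f g ≠ 0 → ∃ k ∈ C.K, ∃ t ∈ s, g = k * t}

/-- The compact induction `ind_K^G σ`, as a submodule of `G → W`. -/
def IndSub : Submodule 𝔽 (S.GG → W) where
  carrier := IndCarrier C 𝔽 W σ
  add_mem' := by
    rintro f g ⟨hf1, sf, hf2⟩ ⟨hg1, sg, hg2⟩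
    refine ⟨fun k hk x => by simp [hf1 k hk x, hg1 k hk x], sf ∪ sg, fun x hx => ?_⟩
    by_cases h : f x ≠ 0
    · obtain ⟨k, hk, t, ht, rfl⟩ := hf2 x h
      exact ⟨k, hk, t, Finset.mem_union_left _ ht, rfl⟩
    · push_neg at h
      have hgx : g x ≠ 0 := by
        intro h0
        apply hx
        simp [Pi.add_apply, h, h0]
      obtain ⟨k, hk, t, ht, rfl⟩ := hg2 x hgx
      exact ⟨k, hk, t, Finset.mem_union_right _ ht, rfl⟩
  zero_mem' := ⟨fun k hk g => by simp, ∅, fun g hg => absurd rfl hg⟩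
  smul_mem' := by
    rintro c f ⟨hf1, sf, hf2⟩
    refine ⟨fun k hk g => by simp [hf1 k hk g], sf, fun x hx => ?_⟩
    refine hf2 x ?_
    intro h0
    apply hx
    simp [h0]

lemma indAct_mem (g : S.GG) {f : S.GG → W} (hf : f ∈ IndCarrier C 𝔽 W σ) :
    (fun x => f (x * g)) ∈ IndCarrier C 𝔽 W σ := by
  obtain ⟨h1, s, h2⟩ := hf
  refine ⟨fun k hk x => ?_, s.image (· * g⁻¹), ?_⟩
  · show f (k * x * g) = _
    rw [mul_assoc]
    exact h1 k hk (x * g)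
  intro x hx
  obtain ⟨k, hk, t, ht, hxg⟩ := h2 (x * g) hx
  refine ⟨k, hk, t * g⁻¹, Finset.mem_image_of_mem _ ht, ?_⟩
  rw [← mul_assoc, ← hxg, mul_assoc, mul_inv_cancel, mul_one]

/-- The representation of `G` on `ind_K^G σ` by right translation. -/
def indRep : Representation 𝔽 S.GG ↥(IndSub C 𝔽 W σ) where
  toFun g :=
    { toFun := fun f => ⟨fun x => (f : S.GG → W) (x * g), indAct_mem C 𝔽 W σ g f.2⟩
      map_add' := fun f1 f2 => Subtype.ext (funext fun x => rfl)
      map_smul' := fun c f => Subtype.ext (funext fun x => rfl) }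
  map_one' := LinearMap.ext fun f => Subtype.ext (funext fun x => by simp [mul_one])
  map_mul' g h := LinearMap.ext fun f => Subtype.ext (funext fun x => by simp [mul_assoc])

/-- The function `[g, v] ∈ ind_K^G σ`: supported on `K g⁻¹`, with value `v` at `g⁻¹`. -/
def stdFn (g : S.GG) (v : W) : S.GG → W :=
  fun x => if h : x * g ∈ C.K then σ ⟨x * g, h⟩ v else 0

/-- The characterization of the family `f_n` (`n ∈ ℤ`) of `I_{1,K}`-invariant elements of
`ind_K^G σ`: `f_n` is supported on `K α⁻ⁿ I_{1,K}` and has value at `α⁻ⁿ` equal to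
`σ(β_K) v₀` for `n > 0` and `v₀` for `n ≤ 0`, where `v₀` is a fixed nonzero vector of
`σ^{I_{1,K}}`. -/
def IsFFamily (v0 : W) (ff : ℤ → ↥(IndSub C 𝔽 W σ)) : Prop :=
  v0 ≠ 0 ∧ (∀ g ∈ C.I1, sigma' C 𝔽 W σ g v0 = v0) ∧
  (∀ (n : ℤ) (g : S.GG), g ∈ C.I1 → indRep C 𝔽 W σ g (ff n) = ff n) ∧
  (∀ (n : ℤ) (x : S.GG), (ff n : S.GG → W) x ≠ 0 →
    ∃ k ∈ C.K, ∃ i ∈ C.I1, x = k * S.alphaE ^ (-n) * i) ∧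
  (∀ n : ℤ, 0 < n → (ff n : S.GG → W) (S.alphaE ^ (-n)) = sigma' C 𝔽 W σ C.βK v0) ∧
  (∀ n : ℤ, n ≤ 0 → (ff n : S.GG → W) (S.alphaE ^ (-n)) = v0)

/-- The characterization of the Hecke operator `T ∈ End_G(ind_K^G σ)`:
it is `G`-equivariant and satisfies
`T [1, v] = ∑_{u ∈ N_{n_K}/N_{n_K+2}} [u α⁻¹, j_σ σ(u⁻¹) v]
  + ∑_{u ∈ N_{n_K+1}/N_{n_K+2}} [β_K u α⁻¹, j_σ σ(β_K) v]`. -/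
def IsHeckeT (jσ : W →ₗ[𝔽] W) (T : Module.End 𝔽 ↥(IndSub C 𝔽 W σ)) : Prop :=
  (∀ (g : S.GG) (x : ↥(IndSub C 𝔽 W σ)),
    T (indRep C 𝔽 W σ g x) = indRep C 𝔽 W σ g (T x)) ∧
  (∀ (v : W) (x : ↥(IndSub C 𝔽 W σ)), (x : S.GG → W) = stdFn C 𝔽 W σ 1 v →
    ∀ (U2 U1 : Finset S.GG),
      S.IsReps (S.Nk C.nK) (S.Nk (C.nK + 2)) U2 →
      S.IsReps (S.Nk (C.nK + 1)) (S.Nk (C.nK + 2)) U1 →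
      ((T x : S.GG → W)) =
        (∑ u ∈ U2, stdFn C 𝔽 W σ (u * S.alphaE⁻¹) (jσ (sigma' C 𝔽 W σ u⁻¹ v))) +
        ∑ u ∈ U1, stdFn C 𝔽 W σ (C.βK * u * S.alphaE⁻¹) (jσ (sigma' C 𝔽 W σ C.βK v)))

/-- The eigencharacter `χ_σ` of `H₀/H₁` afforded by the (one-dimensional) space
`σ^{I_{1,K}}` with chosen basis vector `v₀`. -/
def IsChi (v0 : W) (χ : S.GG → 𝔽) : Prop :=
  (∀ h ∈ C.H0, sigma' C 𝔽 W σ h v0 = χ h • v0)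

/-- Right translation on functions `K → 𝔽` (the action on a (finite) principal series). -/
def PSact (k : ↥C.K) (f : ↥C.K → 𝔽) : ↥C.K → 𝔽 := fun x => f (x * k)

/-- The (inflation to `K` of the) finite principal series `Ind_𝔹^{Γ_K} χ`:
functions on `K`, invariant under right translation by `K¹`, left `I_{1,K}`-invariant and
left `(H₀, χ)`-equivariant. -/
def PSchiSub (χ : S.GG → 𝔽) : Submodule 𝔽 (↥C.K → 𝔽) where
  carrier := {f | (∀ b : ↥C.K, (b : S.GG) ∈ C.I1 → ∀ x, f (b * x) = f x) ∧
                  (∀ h : ↥C.K, (h : S.GG) ∈ C.H0 → ∀ x, f (h * x) = χ (h : S.GG) * f x) ∧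
                  (∀ z : ↥C.K, (z : S.GG) ∈ C.KoneS → ∀ x, f (x * z) = f x)}
  add_mem' := by
    rintro f g ⟨hf1, hf2, hf3⟩ ⟨hg1, hg2, hg3⟩
    exact ⟨fun b hb x => by simp [hf1 b hb x, hg1 b hb x],
           fun h hh x => by simp [hf2 h hh x, hg2 h hh x, mul_add],
           fun z hz x => by simp [hf3 z hz x, hg3 z hz x]⟩
  zero_mem' := ⟨fun b hb x => rfl, fun h hh x => by simp, fun z hz x => rfl⟩
  smul_mem' := by
    rintro c f ⟨hf1, hf2, hf3⟩
    refine ⟨fun b hb x => by simp [hf1 b hb x], fun h hh x => ?_, fun z hz x => by simp [hf3 z hz x]⟩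
    simp only [Pi.smul_apply, hf2 h hh x, smul_eq_mul]
    ring

/-- The principal series `Ind_𝔹^{Γ_K} 1` for the trivial character. -/
def PS1sub : Submodule 𝔽 (↥C.K → 𝔽) := PSchiSub C 𝔽 (fun _ => 1)

/-- `σ_{st}` is the Steinberg weight `st = (Ind_𝔹^{Γ_K} 1)/1`: there is a surjective
`K`-equivariant linear map from `Ind_𝔹^{Γ_K} 1` to it whose kernel is exactly the
constant functions. -/
def IsSteinberg {Wst : Type} [AddCommGroup Wst] [Module 𝔽 Wst]
    (σst : Representation 𝔽 ↥C.K Wst) : Prop :=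
  ∃ φ : ↥(PS1sub C 𝔽) →ₗ[𝔽] Wst, Function.Surjective φ ∧
    (∀ f : ↥(PS1sub C 𝔽), φ f = 0 ↔ ∃ c : 𝔽, (f : ↥C.K → 𝔽) = fun _ => c) ∧
    (∀ (k : ↥C.K) (f f' : ↥(PS1sub C 𝔽)),
      (f' : ↥C.K → 𝔽) = PSact C 𝔽 k (f : ↥C.K → 𝔽) → φ f' = σst k (φ f))

/-- `σ` is isomorphic to a twist of the Steinberg weight by a character. -/
def IsTwistSteinberg : Prop :=
  ∃ (c : ↥C.K →* 𝔽ˣ) (φ : ↥(PS1sub C 𝔽) →ₗ[𝔽] W), Function.Surjective φ ∧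
    (∀ f : ↥(PS1sub C 𝔽), φ f = 0 ↔ ∃ cc : 𝔽, (f : ↥C.K → 𝔽) = fun _ => cc) ∧
    (∀ (k : ↥C.K) (f f' : ↥(PS1sub C 𝔽)),
      (f' : ↥C.K → 𝔽) = PSact C 𝔽 k (f : ↥C.K → 𝔽) →
        φ f' = (c k : 𝔽) • σ k (φ f))


/-- The `K`-subrepresentation of the quotient `(ind_K^G σ) / (range T)` generated by the
image of a vector `v`. -/
def genQuot (T : Module.End 𝔽 ↥(IndSub C 𝔽 W σ)) (v : ↥(IndSub C 𝔽 W σ)) :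
    Submodule 𝔽 (↥(IndSub C 𝔽 W σ) ⧸ LinearMap.range T) :=
  Submodule.span 𝔽 {w | ∃ k ∈ C.K, w = Submodule.Quotient.mk (indRep C 𝔽 W σ k v)}

end Weight

/-- Smoothness of a representation of `G`: every vector is fixed by some congruence
subgroup (equivalently, has open stabilizer). -/
def SmoothRep {V : Type} [AddCommGroup V] [Module 𝔽 V] (ρ : Representation 𝔽 S.GG V) : Prop :=
  ∀ v : V, ∃ n : ℕ, ∀ g ∈ S.cong n, ρ g v = v

end RepTheory

end U21

namespace U21

namespace Setting

variable {S : Setting}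

/-! ### Fractional ideals -/

lemma zero_mem_pE (k : ℤ) : (0 : S.E) ∈ S.pE k := ⟨0, S.O.zero_mem, by simp⟩

lemma mem_pE_zero {z : S.E} : z ∈ S.pE 0 ↔ z ∈ S.O :=
  ⟨fun ⟨w, hw, h⟩ => by simpa [h] using hw, fun h => ⟨z, h, by simp⟩⟩

lemma one_mem_pE_zero : (1 : S.E) ∈ S.pE 0 := mem_pE_zero.2 S.O.one_mem

lemma add_mem_pE {k : ℤ} {a b : S.E} (ha : a ∈ S.pE k) (hb : b ∈ S.pE k) : a + b ∈ S.pE k := by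
  obtain ⟨u, hu, rfl⟩ := ha
  obtain ⟨w, hw, rfl⟩ := hb
  exact ⟨u + w, S.O.add_mem hu hw, by ring⟩

lemma neg_mem_pE {k : ℤ} {a : S.E} (ha : a ∈ S.pE k) : -a ∈ S.pE k := by
  obtain ⟨u, hu, rfl⟩ := ha
  exact ⟨-u, S.O.neg_mem hu, by ring⟩

lemma mul_mem_pE {k l : ℤ} {a b : S.E} (ha : a ∈ S.pE k) (hb : b ∈ S.pE l) :
    a * b ∈ S.pE (k + l) := by
  obtain ⟨u, hu, rfl⟩ := ha
  obtain ⟨w, hw, rfl⟩ := hb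
  exact ⟨u * w, S.O.mul_mem hu hw, by rw [zpow_add₀ S.unif_ne]; ring⟩

lemma pE_mono {k l : ℤ} (h : l ≤ k) {a : S.E} (ha : a ∈ S.pE k) : a ∈ S.pE l := by
  obtain ⟨u, hu, rfl⟩ := ha
  obtain ⟨d, rfl⟩ := Int.le.dest h
  exact ⟨S.ϖ ^ d * u, S.O.mul_mem (S.O.pow_mem S.unif_mem d) hu, by
    rw [zpow_add₀ S.unif_ne, zpow_natCast]; ring⟩

lemma conj_mem_pE {k : ℤ} {a : S.E} (ha : a ∈ S.pE k) : S.conj a ∈ S.pE k := by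
  obtain ⟨u, hu, rfl⟩ := ha
  exact ⟨S.conj u, S.conj_O u hu, by rw [map_mul, map_zpow₀, S.unif_conj]⟩

lemma zpow_mem_pE (k : ℤ) : S.ϖ ^ k ∈ S.pE k := ⟨1, S.O.one_mem, by simp⟩

lemma zpow_mul_mem_pE_iff {k l : ℤ} {a : S.E} : S.ϖ ^ k * a ∈ S.pE l ↔ a ∈ S.pE (l - k) := by
  constructor
  · intro h
    have h2 := mul_mem_pE (zpow_mem_pE (S := S) (-k)) h
    rwa [← mul_assoc, ← zpow_add₀ S.unif_ne, neg_add_cancel, zpow_zero, one_mul,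
      neg_add_eq_sub] at h2
  · intro h
    simpa using mul_mem_pE (zpow_mem_pE (S := S) k) h

lemma one_notMem_pE_one : (1 : S.E) ∉ S.pE 1 := by
  rintro ⟨w, hw, h⟩
  refine S.unif_not_unit (IsUnit.of_mul_eq_one ⟨w, hw⟩ (Subtype.ext ?_))
  simpa using h.symm

lemma mul_sub_one_mem_pE_one {a b : S.E} (ha : a - 1 ∈ S.pE 1) (hb : b - 1 ∈ S.pE 1) :
    a * b - 1 ∈ S.pE 1 := by
  have h : a * b - 1 = (a - 1) * (b - 1) + ((a - 1) + (b - 1)) := by ring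
  rw [h]
  exact add_mem_pE (pE_mono (by omega) (mul_mem_pE ha hb)) (add_mem_pE ha hb)

lemma inv_mem_pE_zero {z : S.E} (hz : z - 1 ∈ S.pE 1) : z ≠ 0 ∧ z⁻¹ ∈ S.pE 0 := by
  have h1 : z ∉ S.pE 1 := fun h => one_notMem_pE_one (S := S) <| by
    simpa using add_mem_pE h (neg_mem_pE hz)
  have h0 : z ≠ 0 := by rintro rfl; exact h1 (zero_mem_pE 1)
  refine ⟨h0, ?_⟩
  obtain ⟨n, u, rfl⟩ := S.disc z h0
  have hn : n ≤ 0 := by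
    by_contra! hn
    exact h1 (pE_mono (by omega : (1 : ℤ) ≤ n) ⟨(u : S.O), (u : S.O).2, mul_comm _ _⟩)
  refine pE_mono (by omega : (0 : ℤ) ≤ -n) ⟨((u⁻¹ : S.Oˣ) : S.O), Subtype.property _, ?_⟩
  have hu : ((u : S.O) : S.E) * ((u⁻¹ : S.Oˣ) : S.O) = 1 := by
    exact_mod_cast congrArg (Subtype.val) (u.mul_inv)
  rw [mul_inv, ← zpow_neg, inv_eq_of_mul_eq_one_right hu, mul_comm]

lemma mem_pE_of_norm {k : ℤ} {x : S.E} (h : x * S.conj x ∈ S.pE (2 * k - 1)) : x ∈ S.pE k := by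
  by_cases h0 : x = 0
  · rw [h0]; exact zero_mem_pE k
  obtain ⟨n, u, rfl⟩ := S.disc x h0
  have hu : ((u : S.O) : S.E) * ((u⁻¹ : S.Oˣ) : S.O) = 1 := by
    exact_mod_cast congrArg (Subtype.val) (u.mul_inv)
  generalize ((u : S.O) : S.E) = a, (((u⁻¹ : S.Oˣ) : S.O) : S.E) = b,
    (u : S.O).2 = ha, (((u⁻¹ : S.Oˣ) : S.O)).2 = hb at *
  have hc : S.conj a * S.conj b = 1 := by rw [← map_mul, hu, map_one]
  by_cases hn : k ≤ n
  · exact pE_mono hn ⟨a, ha, mul_comm _ _⟩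
  exfalso
  have hbb := mul_mem_pE (mem_pE_zero.2 hb) (conj_mem_pE (mem_pE_zero.2 hb))
  have h2 := mul_mem_pE h (mul_mem_pE hbb (zpow_mem_pE (S := S) (-(2 * n))))
  have h1 : a * S.ϖ ^ n * S.conj (a * S.ϖ ^ n) * (b * S.conj b * S.ϖ ^ (-(2 * n))) = 1 := by
    rw [map_mul, map_zpow₀, S.unif_conj, zpow_neg, two_mul, zpow_add₀ S.unif_ne]
    have hw : S.ϖ ^ n ≠ 0 := zpow_ne_zero _ S.unif_ne
    field_simp
    linear_combination (S.conj a * S.conj b) * hu + hc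
  rw [h1] at h2
  exact one_notMem_pE_one (pE_mono (by omega) h2)

lemma mem_pE_of_trace {k l : ℤ} (hkl : 2 * k - 1 ≤ l) {x y : S.E}
    (h : x * S.conj x + y + S.conj y = 0) (hy : y ∈ S.pE l) : x ∈ S.pE k := by
  refine mem_pE_of_norm (pE_mono hkl ?_)
  have : x * S.conj x = -(y + S.conj y) := by linear_combination h
  rw [this]
  exact neg_mem_pE (add_mem_pE hy (conj_mem_pE hy))

/-! ### Matrix entries of elements of `G` -/

lemma mat_mul (g h : S.GG) : S.mat (g * h) = S.mat g * S.mat h := rfl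

lemma mat_one : S.mat 1 = 1 := rfl

lemma mat_injective : Function.Injective S.mat := fun _ _ h => Subtype.ext (Units.ext h)

lemma mat_inv (g : S.GG) (i j : Fin 3) : S.mat g⁻¹ i j = S.conj (S.mat g j.rev i.rev) := by
  have h : (S.mat g).transpose * S.betaM * (S.mat g).map S.conj = S.betaM := g.2
  have h1 : S.mat g⁻¹ = S.betaM * ((S.mat g).map S.conj).transpose * S.betaM := by
    have h2 : S.mat g * S.mat g⁻¹ = 1 := by rw [← mat_mul, mul_inv_cancel, mat_one]
    have h3 := congrArg Matrix.transpose h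
    have hb : S.betaM.transpose = S.betaM := by
      ext i j; fin_cases i <;> fin_cases j <;> simp [betaM]
    simp only [Matrix.transpose_mul, Matrix.transpose_transpose, hb] at h3
    calc S.mat g⁻¹ = S.betaM * S.betaM * S.mat g⁻¹ := by rw [beta_mul_beta, one_mul]
      _ = S.betaM * (((S.mat g).map S.conj).transpose * (S.betaM * S.mat g)) * S.mat g⁻¹ := by
        rw [h3]
      _ = S.betaM * ((S.mat g).map S.conj).transpose * S.betaM * (S.mat g * S.mat g⁻¹) := by
        simp only [mul_assoc]
      _ = _ := by rw [h2, mul_one]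
  rw [h1]
  fin_cases i <;> fin_cases j <;>
    simp [betaM, Matrix.mul_apply, Matrix.vecMul, dotProduct, Fin.sum_univ_three]

/-- The unitarity relation between two columns. -/
lemma col_rel (g : S.GG) (i j : Fin 3) :
    S.mat g 0 i * S.conj (S.mat g 2 j) + S.mat g 1 i * S.conj (S.mat g 1 j)
      + S.mat g 2 i * S.conj (S.mat g 0 j) = S.betaM i j := by
  have h : (S.mat g).transpose * S.betaM * (S.mat g).map S.conj = S.betaM := g.2
  rw [← h]
  simp [betaM, Matrix.mul_apply, Fin.sum_univ_three]
  ring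

/-! ### The pro-`p` Iwahori subgroups -/

/-- The exponents of the fractional ideals containing the entries of the pro-`p` Iwahori. -/
def level (n : ℤ) : Matrix (Fin 3) (Fin 3) ℤ := !![0, 0, n; 1, 0, 0; 1 - n, 1, 0]

/-- The common description of the pro-`p` Iwahori subgroups of `K₀` (`n = 0`) and
`K₁` (`n = -1`). -/
def proPIwahori (S : Setting) (n : ℤ) (hn : -1 ≤ n ∧ n ≤ 0) : Subgroup S.GG where
  carrier := {g | (∀ i j, S.mat g i j ∈ S.pE (level n i j)) ∧ ∀ i, S.mat g i i - 1 ∈ S.pE 1}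
  one_mem' := by
    refine ⟨fun i j => ?_, fun i => ?_⟩
    · rw [mat_one]
      fin_cases i <;> fin_cases j <;> simp [level, zero_mem_pE, one_mem_pE_zero]
    · simp [mat_one, zero_mem_pE]
  mul_mem' := by
    rintro a b ⟨ha, ha'⟩ ⟨hb, hb'⟩
    have key : ∀ i j k, ∀ l ≤ level n i j + level n j k, S.mat a i j * S.mat b j k ∈ S.pE l :=
      fun i j k l hl => pE_mono hl (mul_mem_pE (ha i j) (hb j k))
    refine ⟨fun i k => ?_, fun i => ?_⟩
    · rw [mat_mul, Matrix.mul_apply, Fin.sum_univ_three]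
      refine add_mem_pE (add_mem_pE (key _ _ _ _ ?_) (key _ _ _ _ ?_)) (key _ _ _ _ ?_) <;>
        fin_cases i <;> fin_cases k <;> simp [level] <;> omega
    · have hd := mul_sub_one_mem_pE_one (ha' i) (hb' i)
      rw [mat_mul, Matrix.mul_apply, Fin.sum_univ_three]
      fin_cases i
      · convert add_mem_pE (add_mem_pE hd (key 0 1 0 1 ?_)) (key 0 2 0 1 ?_) using 1
        · simp; ring
        all_goals simp [level]
      · convert add_mem_pE (add_mem_pE hd (key 1 0 1 1 ?_)) (key 1 2 1 1 ?_) using 1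
        · simp; ring
        all_goals simp [level]
      · convert add_mem_pE (add_mem_pE hd (key 2 0 2 1 ?_)) (key 2 1 2 1 ?_) using 1
        · simp; ring
        all_goals simp [level]
  inv_mem' := by
    rintro a ⟨ha, ha'⟩
    refine ⟨fun i j => ?_, fun i => ?_⟩
    · rw [mat_inv]
      have hl : level n i j = level n j.rev i.rev := by
        fin_cases i <;> fin_cases j <;> rfl
      rw [hl]
      exact conj_mem_pE (ha _ _)
    · rw [mat_inv]
      simpa using conj_mem_pE (ha' i.rev)

lemma mem_proPIwahori {n : ℤ} {hn : -1 ≤ n ∧ n ≤ 0} {g : S.GG} :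
    g ∈ S.proPIwahori n hn ↔
      (∀ i j, S.mat g i j ∈ S.pE (level n i j)) ∧ ∀ i, S.mat g i i - 1 ∈ S.pE 1 := Iff.rfl

lemma mem_I1K0_iff {g : S.GG} : g ∈ S.I1K0 ↔ g ∈ S.proPIwahori 0 (by norm_num) := by
  simp only [mem_proPIwahori, I1K0, IK0, K0set, Set.mem_ofPred_eq, Fin.forall_fin_succ,
    ← mem_pE_zero, level]
  simp
  have h1 : ∀ {z : S.E}, z ∈ S.pE 1 → z ∈ S.pE 0 := pE_mono (by norm_num)
  tauto

lemma mem_I1K1_iff {g : S.GG} : g ∈ S.I1K1 ↔ g ∈ S.proPIwahori (-1) (by norm_num) := by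
  simp only [mem_proPIwahori, I1K1, IK1, K1set, Set.mem_ofPred_eq, Fin.forall_fin_succ,
    ← mem_pE_zero, level]
  simp
  have h1 : ∀ {z : S.E}, z ∈ S.pE 2 → z ∈ S.pE 1 := pE_mono (by norm_num)
  tauto

/-- The matrix of `β α ^ r`. -/
def reflM (S : Setting) (r : ℤ) : S.M3 := !![0, 0, S.ϖ ^ r; 0, 1, 0; S.ϖ ^ (-r), 0, 0]

lemma mat_conj_refl {r : ℤ} {t : S.GG} (ht : S.mat t = S.reflM r) (c : S.GG) (i j : Fin 3) :
    S.mat (t⁻¹ * c * t) i j =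
      S.ϖ ^ (r * ((j : ℕ) - (i : ℕ) : ℤ)) * S.mat c i.rev j.rev := by
  have hw : S.ϖ ^ r ≠ 0 := zpow_ne_zero _ S.unif_ne
  have hti : t⁻¹ = t := by
    refine inv_eq_of_mul_eq_one_right (mat_injective ?_)
    rw [mat_mul, ht, mat_one]
    ext i j
    fin_cases i <;> fin_cases j <;>
      simp [reflM, Matrix.mul_apply, Fin.sum_univ_three, hw]
  rw [hti, mat_mul, mat_mul, ht]
  fin_cases i <;> fin_cases j <;>
    simp [reflM, Matrix.mul_apply, Matrix.vecMul, dotProduct, Fin.sum_univ_three, mul_two,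
      zpow_add₀ S.unif_ne] <;>
    field_simp

/-- The exponents describing the conjugate of the pro-`p` Iwahori by `β α ^ r`. -/
def conjLevel (n r : ℤ) : Matrix (Fin 3) (Fin 3) ℤ :=
  !![0, 1 + r, 1 - n + 2 * r; -r, 0, 1 + r; n - 2 * r, -r, 0]

lemma conj_mem_proPIwahori {n r : ℤ} {hn : -1 ≤ n ∧ n ≤ 0} {t : S.GG}
    (ht : S.mat t = S.reflM r) {c : S.GG} :
    t⁻¹ * c * t ∈ S.proPIwahori n hn ↔
      (∀ i j, S.mat c i j ∈ S.pE (conjLevel n r i j)) ∧ ∀ i, S.mat c i i - 1 ∈ S.pE 1 := by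
  have hl : ∀ i j : Fin 3, level n i j - r * ((j : ℕ) - (i : ℕ) : ℤ) =
      conjLevel n r i.rev j.rev := by
    intro i j
    fin_cases i <;> fin_cases j <;> simp [level, conjLevel] <;> ring
  simp only [mem_proPIwahori, mat_conj_refl ht, zpow_mul_mem_pE_iff, hl, sub_self, mul_zero,
    zpow_zero, one_mul]
  refine and_congr ⟨fun h i j => ?_, fun h i j => h _ _⟩ ⟨fun h i => ?_, fun h i => h _⟩
  · simpa using h i.rev j.rev
  · simpa using h i.rev

/-! ### The unipotent subgroups -/

/-- The upper triangular unipotent subgroup of `G`. -/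
def upperN (S : Setting) : Subgroup S.GG where
  carrier := {g | (∀ i j, j < i → S.mat g i j = 0) ∧ ∀ i, S.mat g i i = 1}
  one_mem' := by simp +contextual [mat_one, ne_of_gt]
  mul_mem' := by
    rintro a b ⟨ha, ha'⟩ ⟨hb, hb'⟩
    simp only [Set.mem_ofPred_eq, mat_mul, Matrix.mul_apply, Fin.sum_univ_three,
      Fin.forall_fin_succ] at *
    simp_all
  inv_mem' := by
    rintro a ⟨ha, ha'⟩
    exact ⟨fun i j h => by rw [mat_inv, ha _ _ (Fin.rev_lt_rev.2 h), map_zero],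
      fun i => by rw [mat_inv, ha', map_one]⟩

/-- The lower triangular unipotent subgroup of `G`. -/
def lowerN (S : Setting) : Subgroup S.GG where
  carrier := {g | (∀ i j, i < j → S.mat g i j = 0) ∧ ∀ i, S.mat g i i = 1}
  one_mem' := by simp +contextual [mat_one, ne_of_lt]
  mul_mem' := by
    rintro a b ⟨ha, ha'⟩ ⟨hb, hb'⟩
    simp only [Set.mem_ofPred_eq, mat_mul, Matrix.mul_apply, Fin.sum_univ_three,
      Fin.forall_fin_succ] at *
    simp_all
  inv_mem' := by
    rintro a ⟨ha, ha'⟩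
    exact ⟨fun i j h => by rw [mat_inv, ha _ _ (Fin.rev_lt_rev.2 h), map_zero],
      fun i => by rw [mat_inv, ha', map_one]⟩

lemma mem_upperN_iff {g : S.GG} : g ∈ S.upperN ↔
    ∃ x y : S.E, x * S.conj x + y + S.conj y = 0 ∧ S.mat g = S.nM x y := by
  constructor
  · rintro ⟨h0, h1⟩
    have h10 := h0 1 0 (by decide)
    have h20 := h0 2 0 (by decide)
    have h21 := h0 2 1 (by decide)
    have r1 := col_rel g 1 2
    have r2 := col_rel g 2 2
    simp [h1, h21, betaM] at r1 r2
    have r3 : S.mat g 1 2 = - S.conj (S.mat g 0 1) := by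
      have := congrArg S.conj r1
      simp [S.conj_invol] at this
      linear_combination this
    refine ⟨S.mat g 0 1, S.mat g 0 2, ?_, ?_⟩
    · rw [r3] at r2
      simp [S.conj_invol] at r2
      linear_combination r2
    · ext i j
      fin_cases i <;> fin_cases j <;> simp [nM, *]
  · rintro ⟨x, y, -, h⟩
    refine ⟨fun i j hij => ?_, fun i => ?_⟩ <;> rw [h]
    · fin_cases i <;> fin_cases j <;> simp [nM] at hij ⊢
    · fin_cases i <;> simp [nM]

lemma mem_lowerN_iff {g : S.GG} : g ∈ S.lowerN ↔
    ∃ x y : S.E, x * S.conj x + y + S.conj y = 0 ∧ S.mat g = S.n'M x y := by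
  constructor
  · rintro ⟨h0, h1⟩
    have h01 := h0 0 1 (by decide)
    have h02 := h0 0 2 (by decide)
    have h12 := h0 1 2 (by decide)
    have r1 := col_rel g 1 0
    have r2 := col_rel g 0 0
    simp [h1, h01, betaM] at r1 r2
    have r3 : S.mat g 2 1 = - S.conj (S.mat g 1 0) := by linear_combination r1
    refine ⟨S.mat g 1 0, S.mat g 2 0, ?_, ?_⟩
    · linear_combination r2
    · ext i j
      fin_cases i <;> fin_cases j <;> simp [n'M, *]
  · rintro ⟨x, y, -, h⟩
    refine ⟨fun i j hij => ?_, fun i => ?_⟩ <;> rw [h]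
    · fin_cases i <;> fin_cases j <;> simp [n'M] at hij ⊢
    · fin_cases i <;> simp [n'M]

lemma exists_mat_eq_nM {x y : S.E} (h : x * S.conj x + y + S.conj y = 0) :
    ∃ g : S.GG, S.mat g = S.nM x y := by
  refine ⟨⟨⟨S.nM x y, S.nM (-x) (S.conj y), ?_, ?_⟩, ?_⟩, rfl⟩
  · ext i j
    fin_cases i <;> fin_cases j <;> simp [nM, Matrix.mul_apply, Fin.sum_univ_three]
    linear_combination h
  · ext i j
    fin_cases i <;> fin_cases j <;> simp [nM, Matrix.mul_apply, Fin.sum_univ_three]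
    linear_combination h
  · change (S.nM x y).transpose * S.betaM * (S.nM x y).map S.conj = S.betaM
    ext i j
    fin_cases i <;> fin_cases j <;>
      simp [nM, betaM, Matrix.mul_apply, Fin.sum_univ_three, S.conj_invol]
    linear_combination h

lemma exists_mat_eq_n'M {x y : S.E} (h : x * S.conj x + y + S.conj y = 0) :
    ∃ g : S.GG, S.mat g = S.n'M x y := by
  refine ⟨⟨⟨S.n'M x y, S.n'M (-x) (S.conj y), ?_, ?_⟩, ?_⟩, rfl⟩
  · ext i j
    fin_cases i <;> fin_cases j <;> simp [n'M, Matrix.mul_apply, Fin.sum_univ_three]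
    linear_combination h
  · ext i j
    fin_cases i <;> fin_cases j <;> simp [n'M, Matrix.mul_apply, Fin.sum_univ_three]
    linear_combination h
  · change (S.n'M x y).transpose * S.betaM * (S.n'M x y).map S.conj = S.betaM
    ext i j
    fin_cases i <;> fin_cases j <;>
      simp [n'M, betaM, Matrix.mul_apply, Fin.sum_univ_three, S.conj_invol]
    linear_combination h

lemma mem_Nk_iff {n : ℤ} (hn : -1 ≤ n ∧ n ≤ 0) {g : S.GG} :
    g ∈ S.Nk n ↔ g ∈ S.upperN ∧ g ∈ S.proPIwahori n hn := by
  constructor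
  · rintro ⟨x, y, h, hy, hg⟩
    refine ⟨mem_upperN_iff.2 ⟨x, y, h, hg⟩, fun i j => ?_, fun i => ?_⟩ <;> rw [hg]
    · have hx : x ∈ S.pE 0 := mem_pE_of_trace (by omega) h hy
      fin_cases i <;> fin_cases j <;>
        simp [nM, level, zero_mem_pE, one_mem_pE_zero, hx, hy, neg_mem_pE, conj_mem_pE]
    · fin_cases i <;> simp [nM, zero_mem_pE]
  · rintro ⟨h, h1, -⟩
    obtain ⟨x, y, h, hg⟩ := mem_upperN_iff.1 h
    refine ⟨x, y, h, ?_, hg⟩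
    simpa [hg, nM, level] using h1 0 2

lemma mem_Nk_succ_iff {n : ℤ} (hn : -1 ≤ n ∧ n ≤ 0) {t : S.GG} (ht : S.mat t = S.reflM n)
    {g : S.GG} :
    g ∈ S.Nk (n + 1) ↔ g ∈ S.upperN ∧ t⁻¹ * g * t ∈ S.proPIwahori n hn := by
  rw [conj_mem_proPIwahori ht]
  have e : 1 - n + 2 * n = n + 1 := by ring
  constructor
  · rintro ⟨x, y, h, hy, hg⟩
    refine ⟨mem_upperN_iff.2 ⟨x, y, h, hg⟩, fun i j => ?_, fun i => ?_⟩ <;> rw [hg]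
    · have hx : x ∈ S.pE (1 + n) := mem_pE_of_trace (by omega) h hy
      fin_cases i <;> fin_cases j <;>
        simp [nM, conjLevel, zero_mem_pE, one_mem_pE_zero, hx, e, hy, neg_mem_pE, conj_mem_pE]
    · fin_cases i <;> simp [nM, zero_mem_pE]
  · rintro ⟨h, h1, -⟩
    obtain ⟨x, y, h, hg⟩ := mem_upperN_iff.1 h
    refine ⟨x, y, h, ?_, hg⟩
    simpa [hg, nM, conjLevel, e] using h1 0 2

lemma mem_N'k_iff {n : ℤ} (hn : -1 ≤ n ∧ n ≤ 0) {g : S.GG} :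
    g ∈ S.N'k (1 - n) ↔ g ∈ S.lowerN ∧ g ∈ S.proPIwahori n hn := by
  constructor
  · rintro ⟨x, y, h, hy, hg⟩
    refine ⟨mem_lowerN_iff.2 ⟨x, y, h, hg⟩, fun i j => ?_, fun i => ?_⟩ <;> rw [hg]
    · have hx : x ∈ S.pE 1 := mem_pE_of_trace (by omega) h hy
      fin_cases i <;> fin_cases j <;>
        simp [n'M, level, zero_mem_pE, one_mem_pE_zero, hx, hy, neg_mem_pE, conj_mem_pE]
    · fin_cases i <;> simp [n'M, zero_mem_pE]
  · rintro ⟨h, h1, -⟩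
    obtain ⟨x, y, h, hg⟩ := mem_lowerN_iff.1 h
    refine ⟨x, y, h, ?_, hg⟩
    simpa [hg, n'M, level] using h1 2 0

lemma mem_N'k_succ_iff {n : ℤ} (hn : -1 ≤ n ∧ n ≤ 0) {t : S.GG}
    (ht : S.mat t = S.reflM (n - 1)) {g : S.GG} :
    g ∈ S.N'k (1 - n + 1) ↔ g ∈ S.lowerN ∧ t⁻¹ * g * t ∈ S.proPIwahori n hn := by
  rw [conj_mem_proPIwahori ht]
  have e : n - 2 * (n - 1) = 1 - n + 1 := by ring
  constructor
  · rintro ⟨x, y, h, hy, hg⟩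
    refine ⟨mem_lowerN_iff.2 ⟨x, y, h, hg⟩, fun i j => ?_, fun i => ?_⟩ <;> rw [hg]
    · have hx : x ∈ S.pE (1 - n) := mem_pE_of_trace (by omega) h hy
      fin_cases i <;> fin_cases j <;>
        simp [n'M, conjLevel, zero_mem_pE, one_mem_pE_zero, hx, e, hy, neg_mem_pE, conj_mem_pE]
    · fin_cases i <;> simp [n'M, zero_mem_pE]
  · rintro ⟨h, h1, -⟩
    obtain ⟨x, y, h, hg⟩ := mem_lowerN_iff.1 h
    refine ⟨x, y, h, ?_, hg⟩
    simpa [hg, n'M, conjLevel, e] using h1 2 0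

/-! ### Factorization of the pro-`p` Iwahori -/

lemma exists_upper_factor {n : ℤ} (hn : -1 ≤ n ∧ n ≤ 0) {t : S.GG} (ht : S.mat t = S.reflM n)
    {g : S.GG} (hg : g ∈ S.proPIwahori n hn) :
    ∃ a ∈ S.upperN, a ∈ S.proPIwahori n hn ∧ t⁻¹ * (a⁻¹ * g) * t ∈ S.proPIwahori n hn := by
  obtain ⟨h0, hinv⟩ := inv_mem_pE_zero (hg.2 2)
  have hc0 : S.conj (S.mat g 2 2) ≠ 0 := (map_ne_zero _).2 h0
  have r := col_rel g 2 2
  simp [betaM] at r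
  obtain ⟨x, hx⟩ : ∃ x, x = -S.conj (S.mat g 1 2 * (S.mat g 2 2)⁻¹) := ⟨_, rfl⟩
  obtain ⟨y, hy⟩ : ∃ y, y = S.mat g 0 2 * (S.mat g 2 2)⁻¹ := ⟨_, rfl⟩
  have h : x * S.conj x + y + S.conj y = 0 := by
    rw [hx, hy]
    simp only [map_neg, map_mul, map_inv₀, S.conj_invol]
    field_simp
    linear_combination r
  obtain ⟨a, ha⟩ := exists_mat_eq_nM h
  have haN : a ∈ S.Nk n := by
    refine ⟨x, y, h, ?_, ha⟩
    have := mul_mem_pE (hg.1 0 2) hinv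
    simpa [level, ← hy] using this
  rw [mem_Nk_iff hn] at haN
  refine ⟨a, haN.1, haN.2, ?_⟩
  have hc := mul_mem (inv_mem haN.2) hg
  have ha0 : S.mat (a⁻¹ * g) 0 2 = 0 := by
    simp only [mat_mul, Matrix.mul_apply, Fin.sum_univ_three, mat_inv, ha]
    simp [nM, S.conj_invol]
    have e1 : S.mat g 0 2 = y * S.mat g 2 2 := by rw [hy]; field_simp
    have e2 : S.mat g 1 2 = -S.conj x * S.mat g 2 2 := by
      rw [hx]; simp [S.conj_invol]; field_simp
    rw [e1, e2]
    linear_combination (S.mat g 2 2) * h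
  have ha1 : S.mat (a⁻¹ * g) 1 2 = 0 := by
    simp only [mat_mul, Matrix.mul_apply, Fin.sum_univ_three, mat_inv, ha]
    simp [nM, hx, S.conj_invol]
    field_simp
    ring
  generalize a⁻¹ * g = c at *
  obtain ⟨hc22, -⟩ := inv_mem_pE_zero (hc.2 2)
  have ha2 : S.mat c 0 1 = 0 := by
    have := col_rel c 2 1
    simpa [ha0, ha1, betaM, hc22] using this
  rw [conj_mem_proPIwahori ht]
  refine ⟨fun i j => ?_, hc.2⟩
  have hij := hc.1 i j
  fin_cases i <;> fin_cases j <;> simp [conjLevel, level, ha0, ha1, ha2, zero_mem_pE] at hij ⊢ <;>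
    exact pE_mono (by omega) hij

lemma exists_lower_factor {n : ℤ} (hn : -1 ≤ n ∧ n ≤ 0) {t : S.GG}
    (ht : S.mat t = S.reflM (n - 1)) {g : S.GG} (hg : g ∈ S.proPIwahori n hn) :
    ∃ a ∈ S.lowerN, a ∈ S.proPIwahori n hn ∧ t⁻¹ * (a⁻¹ * g) * t ∈ S.proPIwahori n hn := by
  obtain ⟨h0, hinv⟩ := inv_mem_pE_zero (hg.2 0)
  have hc0 : S.conj (S.mat g 0 0) ≠ 0 := (map_ne_zero _).2 h0
  have r := col_rel g 0 0
  simp [betaM] at r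
  obtain ⟨x, hx⟩ : ∃ x, x = S.mat g 1 0 * (S.mat g 0 0)⁻¹ := ⟨_, rfl⟩
  obtain ⟨y, hy⟩ : ∃ y, y = S.mat g 2 0 * (S.mat g 0 0)⁻¹ := ⟨_, rfl⟩
  have h : x * S.conj x + y + S.conj y = 0 := by
    rw [hx, hy]
    simp only [map_mul, map_inv₀]
    field_simp
    linear_combination r
  obtain ⟨a, ha⟩ := exists_mat_eq_n'M h
  have haN : a ∈ S.N'k (1 - n) := by
    refine ⟨x, y, h, ?_, ha⟩
    have := mul_mem_pE (hg.1 2 0) hinv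
    simpa [level, ← hy] using this
  rw [mem_N'k_iff hn] at haN
  refine ⟨a, haN.1, haN.2, ?_⟩
  have hc := mul_mem (inv_mem haN.2) hg
  have ha0 : S.mat (a⁻¹ * g) 2 0 = 0 := by
    simp only [mat_mul, Matrix.mul_apply, Fin.sum_univ_three, mat_inv, ha]
    simp [n'M]
    have e1 : S.mat g 2 0 = y * S.mat g 0 0 := by rw [hy]; field_simp
    have e2 : S.mat g 1 0 = x * S.mat g 0 0 := by rw [hx]; field_simp
    rw [e1, e2]
    linear_combination (S.mat g 0 0) * h
  have ha1 : S.mat (a⁻¹ * g) 1 0 = 0 := by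
    simp only [mat_mul, Matrix.mul_apply, Fin.sum_univ_three, mat_inv, ha]
    simp [n'M, hx, S.conj_invol]
    field_simp
    ring
  generalize a⁻¹ * g = c at *
  obtain ⟨hc00, -⟩ := inv_mem_pE_zero (hc.2 0)
  have ha2 : S.mat c 2 1 = 0 := by
    have := col_rel c 0 1
    simpa [ha0, ha1, betaM, hc00] using this
  rw [conj_mem_proPIwahori ht]
  refine ⟨fun i j => ?_, hc.2⟩
  have hij := hc.1 i j
  fin_cases i <;> fin_cases j <;> simp [conjLevel, level, ha0, ha1, ha2, zero_mem_pE] at hij ⊢ <;>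
    exact pE_mono (by omega) hij

/-! ### Sums over coset representatives -/

/-- If `A = N ∩ I` represents the left cosets of `I ∩ t I t⁻¹` in `I` and
`B = N ∩ t I t⁻¹`, then summing the translates `u t v` of an `I`-fixed vector `v` over `A/B`
is summing over `I t I / I`, and the result is fixed by `I`. -/
lemma sum_reps_fixed {𝔽 V : Type} [Field 𝔽] [AddCommGroup V] [Module 𝔽 V]
    (ρ : Representation 𝔽 S.GG V) (N I : Subgroup S.GG) (t : S.GG) {A B : Set S.GG}
    (hA : ∀ g, g ∈ A ↔ g ∈ N ∧ g ∈ I) (hB : ∀ g, g ∈ B ↔ g ∈ N ∧ t⁻¹ * g * t ∈ I)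
    (hfac : ∀ g ∈ I, ∃ a ∈ N, a ∈ I ∧ t⁻¹ * (a⁻¹ * g) * t ∈ I)
    {v : V} (hv : ∀ g ∈ I, ρ g v = v) {U : Finset S.GG} (hU : S.IsReps A B U)
    {g : S.GG} (hg : g ∈ I) :
    ρ g (∑ u ∈ U, ρ (u * t) v) = ∑ u ∈ U, ρ (u * t) v := by
  obtain ⟨hUA, hrep⟩ := hU
  have hmem : ∀ u ∈ U, u ∈ N ∧ u ∈ I := fun u hu => (hA u).1 (hUA hu)
  have hex : ∀ u : S.GG, ∃ w, u ∈ U → w ∈ U ∧ t⁻¹ * ((g * u)⁻¹ * w) * t ∈ I := by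
    intro u
    by_cases hu : u ∈ U
    · obtain ⟨a, haN, haI, hac⟩ := hfac (g * u) (mul_mem hg (hmem u hu).2)
      obtain ⟨w, ⟨hw, hwB⟩, -⟩ := hrep a ((hA a).2 ⟨haN, haI⟩)
      refine ⟨w, fun _ => ⟨hw, ?_⟩⟩
      have := mul_mem (inv_mem hac) ((hB _).1 hwB).2
      convert this using 1
      group
    · exact ⟨u, fun h => absurd h hu⟩
  choose f hf using hex
  have hinj : Set.InjOn f U := by
    intro u hu w hw hfw
    have h1 := (hf u hu).2
    have h2 := (hf w hw).2
    rw [← hfw] at h2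
    have h3 : u⁻¹ * w ∈ B := by
      refine (hB _).2 ⟨mul_mem (inv_mem (hmem u hu).1) (hmem w hw).1, ?_⟩
      convert mul_mem h1 (inv_mem h2) using 1
      group
    have h4 : u⁻¹ * u ∈ B := (hB _).2 (by simp [one_mem])
    exact (hrep u (hUA hu)).unique ⟨hu, h4⟩ ⟨hw, h3⟩
  have himg : U.image f = U :=
    Finset.eq_of_subset_of_card_le (Finset.image_subset_iff.2 fun u hu => (hf u hu).1)
      (Finset.card_image_of_injOn hinj).ge
  rw [map_sum]
  conv_rhs => rw [← himg, Finset.sum_image hinj]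
  refine Finset.sum_congr rfl fun u hu => ?_
  have h2 : f u * t = g * (u * t) * (t⁻¹ * ((g * u)⁻¹ * f u) * t) := by group
  rw [h2, map_mul ρ (g * (u * t)), Module.End.mul_apply, hv _ (hf u hu).2, map_mul ρ g,
    Module.End.mul_apply]

lemma mat_betaE : S.mat S.betaE = S.reflM 0 := by
  change S.betaM = _
  simp [betaM, reflM]

lemma mat_mul_alphaE_inv {r : ℤ} {t : S.GG} (ht : S.mat t = S.reflM r) :
    S.mat (t * S.alphaE⁻¹) = S.reflM (r - 1) := by
  have hw := S.unif_ne
  rw [mat_mul, ht]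
  change S.reflM r * S.alphaMinv = _
  ext i j
  fin_cases i <;> fin_cases j <;>
    simp [reflM, alphaMinv, Matrix.mul_apply, Fin.sum_univ_three, zpow_sub₀ hw] <;>
    field_simp

end Setting

/-- The uniform description of the data of a chamber in terms of `n_K`. -/
lemma Chamber.exists_proPIwahori {S : Setting} (C : Chamber S) :
    ∃ hn : -1 ≤ C.nK ∧ C.nK ≤ 0, (∀ g, g ∈ C.I1 ↔ g ∈ S.proPIwahori C.nK hn) ∧
      C.mK = 1 - C.nK ∧ S.mat C.βK = S.reflM C.nK := by
  rcases C.cases with ⟨-, -, -, hI, -, hβ, hn, hm, -⟩ | ⟨-, -, -, hI, -, hβ, hn, hm, -⟩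
  · rw [hI, hβ, hn, hm]
    exact ⟨by norm_num, fun g => Setting.mem_I1K0_iff, by norm_num, Setting.mat_betaE⟩
  · rw [hI, hβ, hn, hm]
    exact ⟨by norm_num, fun g => Setting.mem_I1K1_iff, by norm_num,
      Setting.mat_mul_alphaE_inv Setting.mat_betaE⟩

/-- If `v` in a smooth representation `π` of `G` is fixed by `I_{1,K}`,
then so are `S_K(v)` and `S_-(v)`. -/
theorem stmt14
    (S : Setting) (C : Chamber S)
    (𝔽 : Type) [Field 𝔽] [IsAlgClosed 𝔽] [Algebra (ZMod S.p) 𝔽]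
    [Algebra.IsAlgebraic (ZMod S.p) 𝔽]
    (V : Type) [AddCommGroup V] [Module 𝔽 V]
    (ρ : Representation 𝔽 S.GG V) (hρ : SmoothRep 𝔽 ρ)
    (v : V) (hv : ∀ g ∈ C.I1, ρ g v = v) :
    (∀ U : Finset S.GG, S.IsReps (S.Nk C.nK) (S.Nk (C.nK + 1)) U →
      ∀ g ∈ C.I1, ρ g (∑ u ∈ U, ρ (u * C.βK) v) = ∑ u ∈ U, ρ (u * C.βK) v) ∧
    (∀ U' : Finset S.GG, S.IsReps (S.N'k C.mK) (S.N'k (C.mK + 1)) U' →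
      ∀ g ∈ C.I1, ρ g (∑ u ∈ U', ρ (u * C.βK * S.alphaE⁻¹) v) =
        ∑ u ∈ U', ρ (u * C.βK * S.alphaE⁻¹) v) := by
  obtain ⟨hn, hI, hm, hβ⟩ := C.exists_proPIwahori
  have hv' : ∀ g ∈ S.proPIwahori C.nK hn, ρ g v = v := fun g hg => hv g ((hI g).2 hg)
  refine ⟨fun U hU g hg => ?_, fun U hU g hg => ?_⟩
  · exact Setting.sum_reps_fixed ρ S.upperN _ C.βK (fun _ => Setting.mem_Nk_iff hn)
      (fun _ => Setting.mem_Nk_succ_iff hn hβ) (fun _ => Setting.exists_upper_factor hn hβ)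
      hv' hU ((hI g).1 hg)
  · have ht := Setting.mat_mul_alphaE_inv hβ
    rw [hm] at hU
    simp only [mul_assoc]
    exact Setting.sum_reps_fixed ρ S.lowerN _ (C.βK * S.alphaE⁻¹)
      (fun _ => Setting.mem_N'k_iff hn) (fun _ => Setting.mem_N'k_succ_iff hn ht)
      (fun _ => Setting.exists_lower_factor hn ht) hv' hU ((hI g).1 hg)

end U21
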